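/- For any positive integers p, q and any nonnegative integer r, one has ζ⋆({2}^p, {1}^r, {2}^q) + (-1)^{r+1} ζ⋆({2}^q, r+2, {2}^{p-1}) = Σ_{a+b=r-1} (-1)^a · ζ⋆(a+2, {2}^{p-1}) · ζ⋆({1}^{b+1}, {2}^q), where a, b range over nonnegative integers (so the right-hand side is the empty sum 0 when r = 0). -/

import Mathlib

open scoped BigOperators

/-- Multiple zeta value `ζ(α₁,…,α_r) = Σ_{1 ≤ k₁ < ⋯ < k_r} k₁^{-α₁} ⋯ k_r^{-α_r}`;
`mzv [] = 1`. -/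
noncomputable def mzv (α : List ℕ) : ℝ :=
  ∑' f : {f : Fin α.length → ℕ+ // StrictMono f},
    ∏ i : Fin α.length, ((f.1 i : ℝ) ^ (α.get i))⁻¹

/-- Multiple zeta-star value `ζ⋆(α₁,…,α_r) = Σ_{1 ≤ k₁ ≤ ⋯ ≤ k_r} k₁^{-α₁} ⋯ k_r^{-α_r}`;
`mzvStar [] = 1`. -/
noncomputable def mzvStar (α : List ℕ) : ℝ :=
  ∑' f : {f : Fin α.length → ℕ+ // Monotone f},
    ∏ i : Fin α.length, ((f.1 i : ℝ) ^ (α.get i))⁻¹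

/-- `Z_U(α;β) = Σ_{1≤k₁<⋯<k_r} k₁^{-α₁}⋯k_r^{-α_r} Σ_{1≤ℓ₁≤⋯≤ℓ_m≤k_r} ℓ₁^{-β₁}⋯ℓ_m^{-β_m}`. -/
noncomputable def ZU (α β : List ℕ) : ℝ :=
  ∑' p : {p : (Fin α.length → ℕ+) × (Fin β.length → ℕ+) //
      StrictMono p.1 ∧ Monotone p.2 ∧
      ∀ j : Fin β.length, (j : ℕ) = β.length - 1 →
        ∀ i : Fin α.length, (i : ℕ) = α.length - 1 → p.2 j ≤ p.1 i},
    (∏ i : Fin α.length, ((p.1.1 i : ℝ) ^ (α.get i))⁻¹) *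
      ∏ j : Fin β.length, ((p.1.2 j : ℝ) ^ (β.get j))⁻¹

/-- `Z_L(α;β) = Σ_{1≤k₁<⋯<k_r} k₁^{-α₁}⋯k_r^{-α_r} Σ_{k₁≤ℓ₁≤⋯≤ℓ_m} ℓ₁^{-β₁}⋯ℓ_m^{-β_m}`. -/
noncomputable def ZL (α β : List ℕ) : ℝ :=
  ∑' p : {p : (Fin α.length → ℕ+) × (Fin β.length → ℕ+) //
      StrictMono p.1 ∧ Monotone p.2 ∧
      ∀ i : Fin α.length, (i : ℕ) = 0 →
        ∀ j : Fin β.length, (j : ℕ) = 0 → p.1 i ≤ p.2 j},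
    (∏ i : Fin α.length, ((p.1.1 i : ℝ) ^ (α.get i))⁻¹) *
      ∏ j : Fin β.length, ((p.1.2 j : ℝ) ^ (β.get j))⁻¹

/-- `Z_B(α;β) = Σ_{1≤k₁<⋯<k_r} k₁^{-α₁}⋯k_r^{-α_r} Σ_{k₁≤ℓ₁≤⋯≤ℓ_m≤k_r} ℓ₁^{-β₁}⋯ℓ_m^{-β_m}`. -/
noncomputable def ZB (α β : List ℕ) : ℝ :=
  ∑' p : {p : (Fin α.length → ℕ+) × (Fin β.length → ℕ+) //
      StrictMono p.1 ∧ Monotone p.2 ∧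
      (∀ i : Fin α.length, (i : ℕ) = 0 →
        ∀ j : Fin β.length, (j : ℕ) = 0 → p.1 i ≤ p.2 j) ∧
      ∀ j : Fin β.length, (j : ℕ) = β.length - 1 →
        ∀ i : Fin α.length, (i : ℕ) = α.length - 1 → p.2 j ≤ p.1 i},
    (∏ i : Fin α.length, ((p.1.1 i : ℝ) ^ (α.get i))⁻¹) *
      ∏ j : Fin β.length, ((p.1.2 j : ℝ) ^ (β.get j))⁻¹

open scoped NNReal ENNReal

noncomputable section

/-- The weight `n ^ (-a)`, with value `0` at `n = 0`. -/
def zetaWeight (a n : ℕ) : ℝ≥0 := if n = 0 then 0 else ((n : ℝ≥0) ^ a)⁻¹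

/-- The sum of `k₁^{-α₁} ⋯ k_r^{-α_r}` over `m ≤ k₁ ≤ ⋯ ≤ k_r`, with positive `kᵢ`. -/
def starTail : List ℕ → ℕ → ℝ≥0∞
  | [], _ => 1
  | a :: l, m => ∑' n : ℕ, if m ≤ n then zetaWeight a n * starTail l n else 0

/-- The weighted partial-sum operator `f ↦ (n ↦ ∑_{1 ≤ k ≤ n} k^{-a} f k)`. -/
def partialSum (a : ℕ) : Module.End ℝ≥0∞ (ℕ → ℝ≥0∞) where
  toFun f n := ∑ k ∈ Finset.range (n + 1), zetaWeight a k * f k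
  map_add' f g := by
    ext n
    simp [mul_add, Finset.sum_add_distrib]
  map_smul' c f := by
    ext n
    simp only [Pi.smul_apply, smul_eq_mul, RingHom.id_apply, Finset.mul_sum]
    exact Finset.sum_congr rfl fun k _ => by ring

/-- The sum of `f(k₁) k₁^{-α₁} ⋯ k_r^{-α_r}` over `1 ≤ k₁ ≤ ⋯ ≤ k_r`. -/
def starPairing (f : ℕ → ℝ≥0∞) : List ℕ → ℝ≥0∞
  | [] => 0
  | a :: l => ∑' n : ℕ, f n * (zetaWeight a n * starTail l n)

/-- The connector `n! k! / (n + k)!`. -/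
def connector (n k : ℕ) : ℝ≥0 := (n.factorial * k.factorial : ℝ≥0) / (n + k).factorial

lemma partialSum_apply (a : ℕ) (f : ℕ → ℝ≥0∞) (n : ℕ) :
    partialSum a f n = ∑ k ∈ Finset.range (n + 1), zetaWeight a k * f k := rfl

lemma zetaWeight_zero (a : ℕ) : zetaWeight a 0 = 0 := by simp [zetaWeight]

lemma partialSum_zero (a : ℕ) (f : ℕ → ℝ≥0∞) : partialSum a f 0 = 0 := by
  simp [partialSum_apply, zetaWeight_zero]

lemma partialSum_succ (a : ℕ) (f : ℕ → ℝ≥0∞) (n : ℕ) :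
    partialSum a f (n + 1) = partialSum a f n + zetaWeight a (n + 1) * f (n + 1) := by
  simp [partialSum_apply, Finset.sum_range_succ]

lemma starTail_zero_eq_starPairing (a : ℕ) (l : List ℕ) :
    starTail (a :: l) 0 = starPairing 1 (a :: l) := by
  simp [starTail, starPairing]

lemma tsum_mul_tsum_ite (f g : ℕ → ℝ≥0∞) :
    ∑' n, f n * ∑' m, (if n ≤ m then g m else 0) =
      ∑' m, (∑ n ∈ Finset.range (m + 1), f n) * g m := by
  simp_rw [← ENNReal.tsum_mul_left]
  rw [ENNReal.tsum_comm]
  refine tsum_congr fun m => ?_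
  rw [Finset.sum_mul, tsum_eq_sum (s := Finset.range (m + 1))]
  · refine Finset.sum_congr rfl fun n hn => ?_
    rw [if_pos (by simpa [Nat.lt_succ_iff] using hn)]
  · intro n hn
    rw [if_neg (by simpa [Nat.lt_succ_iff] using hn), mul_zero]

lemma starPairing_cons (f : ℕ → ℝ≥0∞) (a : ℕ) {l : List ℕ} (hl : l ≠ []) :
    starPairing f (a :: l) = starPairing (partialSum a f) l := by
  cases l with
  | nil => exact absurd rfl hl
  | cons b l =>
    simp only [starPairing, starTail, partialSum_apply]
    rw [← tsum_mul_tsum_ite]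
    exact tsum_congr fun n => by ring

lemma starPairing_replicate_append (a j : ℕ) {l : List ℕ} (hl : l ≠ []) (f : ℕ → ℝ≥0∞) :
    starPairing f (List.replicate j a ++ l) = starPairing ((partialSum a ^ j) f) l := by
  induction j generalizing f with
  | zero => simp
  | succ j ih =>
    rw [List.replicate_succ, List.cons_append, starPairing_cons _ _ (by simp [hl]), ih,
      pow_succ, Module.End.mul_apply]

lemma starPairing_add (f g : ℕ → ℝ≥0∞) (l : List ℕ) :
    starPairing (f + g) l = starPairing f l + starPairing g l := by
  cases l with
  | nil => simp [starPairing]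
  | cons a l => simp [starPairing, add_mul, ENNReal.tsum_add]

lemma starPairing_smul (c : ℝ≥0∞) (f : ℕ → ℝ≥0∞) (l : List ℕ) :
    starPairing (c • f) l = c * starPairing f l := by
  cases l with
  | nil => simp [starPairing]
  | cons a l => simp [starPairing, mul_assoc, ENNReal.tsum_mul_left]

/-! ### Connector identities -/

lemma connector_comm (n k : ℕ) : connector n k = connector k n := by
  simp [connector, mul_comm, add_comm]

lemma connector_zero_right (n : ℕ) : connector n 0 = 1 := by
  simp [connector, Nat.factorial_ne_zero]

lemma connector_zero_left (k : ℕ) : connector 0 k = 1 := by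
  rw [connector_comm, connector_zero_right]

/-- The transport relation of the connector. -/
lemma connector_mul_zetaWeight_succ (n k a : ℕ) :
    connector n k * zetaWeight (a + 1) k = connector (n + 1) k * zetaWeight (a + 1) k +
      zetaWeight 1 (n + 1) * (connector (n + 1) k * zetaWeight a k) := by
  rcases eq_or_ne k 0 with rfl | hk
  · simp [zetaWeight_zero]
  have hk' : (k : ℝ≥0) ≠ 0 := by exact_mod_cast hk
  have h1 : ((n + k).factorial : ℝ≥0) ≠ 0 := by exact_mod_cast Nat.factorial_ne_zero _
  have h2 : ((n : ℝ≥0) + k + 1) ≠ 0 := by positivity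
  simp only [zetaWeight, connector, hk, if_false, Nat.succ_ne_zero, pow_one,
    show n + 1 + k = (n + k) + 1 by ring, Nat.factorial_succ]
  push_cast
  field_simp
  ring

lemma connector_le (n k : ℕ) (hk : k ≠ 0) : (connector n k : ℝ) ≤ 1 / (n + 1) := by
  obtain ⟨k, rfl⟩ := Nat.exists_eq_succ_of_ne_zero hk
  have h : (n + 1) * (n.factorial * (k + 1).factorial) ≤ (n + (k + 1)).factorial := by
    induction k with
    | zero => simp [Nat.factorial_succ]
    | succ k ih =>
      calc (n + 1) * (n.factorial * (k + 1 + 1).factorial)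
          = (k + 1 + 1) * ((n + 1) * (n.factorial * (k + 1).factorial)) := by
            rw [Nat.factorial_succ (k + 1)]
            ring
        _ ≤ (n + (k + 1) + 1) * (n + (k + 1)).factorial :=
            Nat.mul_le_mul (by omega) (ih k.succ_ne_zero)
        _ = (n + (k + 1 + 1)).factorial := (Nat.factorial_succ _).symm
  have h' : ((n : ℝ) + 1) * (n.factorial * (k + 1).factorial) ≤ (n + (k + 1)).factorial := by
    exact_mod_cast h
  have h1 : (0 : ℝ) < (n + (k + 1)).factorial := by exact_mod_cast Nat.factorial_pos _
  simp only [connector, NNReal.coe_div, NNReal.coe_mul, NNReal.coe_natCast, Nat.succ_eq_add_one]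
  rw [div_le_div_iff₀ h1 (by positivity)]
  linarith

lemma sum_connector (k N : ℕ) (hk : k ≠ 0) :
    ∑ n ∈ Finset.range (N + 1), zetaWeight 1 n * connector n k + zetaWeight 1 k * connector N k =
      zetaWeight 1 k := by
  induction N with
  | zero => simp [zetaWeight_zero, connector_zero_left]
  | succ N ih =>
    rw [Finset.sum_range_succ]
    conv_rhs => rw [← ih]
    have h := connector_mul_zetaWeight_succ N k 0
    have h0 : zetaWeight 0 k = 1 := by simp [zetaWeight, hk]
    rw [h0, zero_add, mul_one] at h
    rw [mul_comm (zetaWeight 1 k) (connector N k), h]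
    ring

lemma tsum_connector (k : ℕ) (hk : k ≠ 0) :
    ∑' n, (zetaWeight 1 n * connector n k : ℝ≥0∞) = zetaWeight 1 k := by
  have hc : Filter.Tendsto (fun n => (connector n k : ℝ)) Filter.atTop (nhds 0) :=
    squeeze_zero (fun n => NNReal.coe_nonneg _) (fun n => connector_le n k hk)
      tendsto_one_div_add_atTop_nhds_zero_nat
  have hs : HasSum (fun n => ((zetaWeight 1 n * connector n k : ℝ≥0) : ℝ)) (zetaWeight 1 k) := by
    rw [hasSum_iff_tendsto_nat_of_nonneg (fun n => NNReal.coe_nonneg _),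
      ← Filter.tendsto_add_atTop_iff_nat 1]
    have h : ∀ N, ∑ n ∈ Finset.range (N + 1), ((zetaWeight 1 n * connector n k : ℝ≥0) : ℝ) =
        zetaWeight 1 k - zetaWeight 1 k * connector N k := fun N => by
      rw [eq_sub_iff_add_eq]
      exact_mod_cast sum_connector k N hk
    simp_rw [h]
    simpa using (tendsto_const_nhds (x := (zetaWeight 1 k : ℝ))).sub (hc.const_mul _)
  have := ENNReal.tsum_coe_eq (NNReal.hasSum_coe.mp hs)
  simpa using this

/-! ### Finiteness -/

lemma tsum_zetaWeight_two_ne_top : ∑' n, (zetaWeight 2 n : ℝ≥0∞) ≠ ⊤ := by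
  rw [ENNReal.tsum_coe_ne_top_iff_summable, ← NNReal.summable_coe]
  refine (Real.summable_nat_pow_inv (p := 2)).2 (by norm_num) |>.congr fun n => ?_
  rcases eq_or_ne n 0 with rfl | hn <;> simp [zetaWeight, *]

lemma starTail_le_zero (l : List ℕ) (m : ℕ) : starTail l m ≤ starTail l 0 := by
  cases l with
  | nil => simp [starTail]
  | cons a l =>
    refine ENNReal.tsum_le_tsum fun n => ?_
    split_ifs <;> simp_all

lemma starTail_replicate_two_ne_top (s : ℕ) : starTail (List.replicate s 2) 0 ≠ ⊤ := by
  induction s with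
  | zero => simp [starTail]
  | succ s ih =>
    have h : starTail (List.replicate (s + 1) 2) 0 ≤
        (∑' n, (zetaWeight 2 n : ℝ≥0∞)) * starTail (List.replicate s 2) 0 := by
      rw [List.replicate_succ, starTail, ← ENNReal.tsum_mul_right]
      refine ENNReal.tsum_le_tsum fun n => ?_
      simp only [zero_le, if_true]
      gcongr
      exact starTail_le_zero _ _
    exact ne_top_of_le_ne_top (ENNReal.mul_ne_top tsum_zetaWeight_two_ne_top ih) h

lemma partialSum_one_pow_le (j n : ℕ) :
    (partialSum 1 ^ j) 1 (n + 1) ≤ ENNReal.ofReal (2 ^ j * √(n + 1 : ℕ)) := by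
  induction j generalizing n with
  | zero => simp
  | succ j ih =>
    rw [pow_succ', Module.End.mul_apply]
    have hstep : ∀ n : ℕ, 2 * √(n : ℕ) + (n + 1 : ℝ)⁻¹ * √(n + 1 : ℕ) ≤ 2 * √(n + 1 : ℕ) := by
      intro n
      have hs := Real.sqrt_nonneg (n : ℝ)
      have ht : 0 < √((n + 1 : ℕ) : ℝ) := Real.sqrt_pos.mpr (by positivity)
      have hs2 := Real.sq_sqrt (Nat.cast_nonneg (α := ℝ) n)
      have ht2 := Real.sq_sqrt (Nat.cast_nonneg (α := ℝ) (n + 1))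
      have hcast : ((n + 1 : ℕ) : ℝ) = n + 1 := by push_cast; ring
      rw [← hcast]
      nth_rewrite 1 [← ht2]
      rw [pow_two, mul_inv, mul_assoc, inv_mul_cancel₀ ht.ne', mul_one, ← le_sub_iff_add_le',
        inv_le_iff_one_le_mul₀ ht]
      nlinarith [sq_nonneg (√((n + 1 : ℕ) : ℝ) - √(n : ℝ))]
    have hterm : ∀ n : ℕ, (zetaWeight 1 (n + 1) : ℝ≥0∞) * (partialSum 1 ^ j) 1 (n + 1) ≤
        ENNReal.ofReal (2 ^ j * ((n + 1 : ℝ)⁻¹ * √(n + 1 : ℕ))) := by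
      intro n
      have hw : (zetaWeight 1 (n + 1) : ℝ≥0∞) = ENNReal.ofReal ((n + 1 : ℝ)⁻¹) := by
        rw [ENNReal.ofReal, ENNReal.coe_inj]
        ext
        rw [Real.coe_toNNReal _ (by positivity)]
        simp [zetaWeight]
      rw [hw, mul_left_comm, ENNReal.ofReal_mul (by positivity)]
      gcongr
      exact ih n
    have hall : ∀ n : ℕ, partialSum 1 ((partialSum 1 ^ j) 1) n ≤
        ENNReal.ofReal (2 ^ (j + 1) * √(n : ℕ)) := by
      intro n
      induction n with
      | zero => simp [partialSum_zero]
      | succ n ihn =>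
        rw [partialSum_succ]
        refine (add_le_add ihn (hterm n)).trans ?_
        rw [← ENNReal.ofReal_add (by positivity) (by positivity)]
        refine ENNReal.ofReal_le_ofReal ?_
        have := mul_le_mul_of_nonneg_left (hstep n) (show (0 : ℝ) ≤ 2 ^ j by positivity)
        rw [pow_succ]
        linarith
    exact hall _

lemma starPairing_partialSum_one_pow_ne_top (j s : ℕ) :
    starPairing ((partialSum 1 ^ j) 1) (2 :: List.replicate s 2) ≠ ⊤ := by
  have hsum : ∑' n : ℕ, ENNReal.ofReal (2 ^ j * √(n : ℕ)) * zetaWeight 2 n ≠ ⊤ := by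
    have hreal : Summable fun n : ℕ => 2 ^ j * ((n : ℝ) ^ (3 / 2 : ℝ))⁻¹ :=
      (Real.summable_nat_rpow_inv.mpr (by norm_num)).mul_left _
    convert hreal.tsum_ofReal_ne_top using 3 with n
    rcases eq_or_ne n 0 with rfl | hn
    · simp [zetaWeight_zero]
    have hn' : (0 : ℝ) < n := by exact_mod_cast Nat.pos_of_ne_zero hn
    rw [← ENNReal.ofReal_coe_nnreal, ← ENNReal.ofReal_mul (by positivity), mul_assoc]
    congr 2
    simp only [zetaWeight, hn, if_false, NNReal.coe_inv, NNReal.coe_pow, NNReal.coe_natCast]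
    rw [Real.sqrt_eq_rpow, ← Real.rpow_natCast, ← Real.rpow_neg hn'.le, ← Real.rpow_neg hn'.le,
      ← Real.rpow_add hn']
    norm_num
  refine ne_top_of_le_ne_top
    (ENNReal.mul_ne_top hsum (starTail_replicate_two_ne_top s)) ?_
  rw [starPairing, ← ENNReal.tsum_mul_right]
  refine ENNReal.tsum_le_tsum fun n => ?_
  rw [← mul_assoc]
  cases n with
  | zero => simp [zetaWeight_zero]
  | succ n =>
    gcongr
    · exact partialSum_one_pow_le j n
    · exact starTail_le_zero _ _

/-! ### Connected sums -/

/-- `∑ₖ c(n,k) k^{-(r+2)} ∑_{k ≤ k₁ ≤ ⋯ ≤ k_s} (k₁ ⋯ k_s)^{-2}`. -/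
def connectedSum (s r n : ℕ) : ℝ≥0∞ :=
  ∑' k, connector n k * (zetaWeight (r + 2) k * starTail (List.replicate s 2) k)

lemma connectedSum_zero (s r : ℕ) :
    connectedSum s r 0 = starTail ((r + 2) :: List.replicate s 2) 0 := by
  simp [connectedSum, connector_zero_left, starTail]

lemma connectedSum_eq_succ (s a n : ℕ) :
    ∑' k, connector n k * (zetaWeight (a + 1) k * starTail (List.replicate s 2) k) =
      ∑' k, connector (n + 1) k * (zetaWeight (a + 1) k * starTail (List.replicate s 2) k) +
      zetaWeight 1 (n + 1) *
        ∑' k, connector (n + 1) k * (zetaWeight a k * starTail (List.replicate s 2) k) := by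
  rw [← ENNReal.tsum_mul_left, ← ENNReal.tsum_add]
  refine tsum_congr fun k => ?_
  have h : (connector n k * zetaWeight (a + 1) k : ℝ≥0∞) =
      connector (n + 1) k * zetaWeight (a + 1) k +
        zetaWeight 1 (n + 1) * (connector (n + 1) k * zetaWeight a k) := by
    exact_mod_cast connector_mul_zetaWeight_succ n k a
  rw [← mul_assoc, h]
  ring

lemma connectedSum_succ_add_partialSum (s r : ℕ) :
    connectedSum s (r + 1) + partialSum 1 (connectedSum s r) =
      starTail ((r + 3) :: List.replicate s 2) 0 • (1 : ℕ → ℝ≥0∞) := by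
  ext n
  simp only [Pi.add_apply, Pi.smul_apply, Pi.one_apply, smul_eq_mul, mul_one]
  induction n with
  | zero => rw [connectedSum_zero, partialSum_zero, add_zero]
  | succ n ih =>
    rw [← ih, partialSum_succ, connectedSum, connectedSum, connectedSum,
      connectedSum_eq_succ s (r + 2) n]
    ring

lemma zetaWeight_two (n : ℕ) : zetaWeight 2 n = zetaWeight 1 n * zetaWeight 1 n := by
  simp only [zetaWeight]
  split_ifs
  · simp
  · rw [pow_two, pow_one, mul_inv]

/-- If the depth-`s` sum connected through `n⁻¹` is known, so is the sum connected
through `n⁻²`. -/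
lemma connectedSum_add_partialSum_of (s : ℕ)
    (h : ∀ n ≠ 0, ∑' k, connector n k * (zetaWeight 1 k * starTail (List.replicate s 2) k) =
      zetaWeight 1 n * (partialSum 2 ^ s) 1 n) :
    connectedSum s 0 + (partialSum 2 ^ (s + 1)) 1 =
      starTail (List.replicate (s + 1) 2) 0 • (1 : ℕ → ℝ≥0∞) := by
  ext n
  simp only [Pi.add_apply, Pi.smul_apply, Pi.one_apply, smul_eq_mul, mul_one, pow_succ',
    Module.End.mul_apply]
  induction n with
  | zero => rw [connectedSum_zero, partialSum_zero, add_zero, List.replicate_succ]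
  | succ n ih =>
    rw [← ih, partialSum_succ, connectedSum, connectedSum, connectedSum_eq_succ s 1 n,
      h (n + 1) n.succ_ne_zero, zetaWeight_two]
    push_cast
    ring

lemma tsum_connector_mul_starTail (s n : ℕ) (hn : n ≠ 0) :
    ∑' k, connector n k * (zetaWeight 1 k * starTail (List.replicate s 2) k) =
      zetaWeight 1 n * (partialSum 2 ^ s) 1 n := by
  induction s generalizing n with
  | zero =>
    simp only [List.replicate_zero, starTail, mul_one, pow_zero, Module.End.one_apply,
      Pi.one_apply]
    rw [← tsum_connector n hn]
    exact tsum_congr fun k => by rw [connector_comm, mul_comm]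
  | succ s ih =>
    have hW := congrFun (connectedSum_add_partialSum_of s ih) n
    simp only [Pi.add_apply, Pi.smul_apply, Pi.one_apply, smul_eq_mul, mul_one] at hW
    have hfin : connectedSum s 0 n ≠ ⊤ :=
      ne_top_of_le_ne_top (starTail_replicate_two_ne_top (s + 1)) (hW ▸ le_self_add)
    refine (ENNReal.add_left_inj (ENNReal.mul_ne_top (ENNReal.coe_ne_top (r := zetaWeight 1 n))
      hfin)).mp ?_
    rw [← mul_add, add_comm ((partialSum 2 ^ (s + 1)) 1 n), hW]
    simp only [List.replicate_succ, starTail, connectedSum, ← mul_assoc]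
    rw [tsum_mul_tsum_ite, ← ENNReal.tsum_mul_left, ← ENNReal.tsum_mul_left, ← ENNReal.tsum_add]
    refine tsum_congr fun m => ?_
    have h : (∑ k ∈ Finset.range (m + 1), (zetaWeight 1 k * connector k n : ℝ≥0∞)) +
        zetaWeight 1 n * connector m n = zetaWeight 1 n := by
      exact_mod_cast sum_connector n m hn
    simp only [zero_le, if_true]
    conv_rhs => rw [← h]
    simp only [connector_comm n, mul_comm (connector _ n : ℝ≥0∞) (zetaWeight 1 _ : ℝ≥0∞)]
    ring

lemma connectedSum_add_partialSum (s : ℕ) :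
    connectedSum s 0 + (partialSum 2 ^ (s + 1)) 1 =
      starTail (List.replicate (s + 1) 2) 0 • (1 : ℕ → ℝ≥0∞) :=
  connectedSum_add_partialSum_of s fun n hn => tsum_connector_mul_starTail s n hn

/-- Exchanging the two sides of a doubly connected sum. -/
lemma starPairing_connectedSum_add (s t r : ℕ) :
    starPairing (connectedSum s r) (2 :: List.replicate t 2) +
      starPairing ((partialSum 2 ^ (t + 1)) 1) ((r + 2) :: List.replicate s 2) =
    starTail ((r + 2) :: List.replicate s 2) 0 * starTail (List.replicate (t + 1) 2) 0 := by
  have h : starPairing (connectedSum s r) (2 :: List.replicate t 2) =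
      starPairing (connectedSum t 0) ((r + 2) :: List.replicate s 2) := by
    simp only [starPairing, connectedSum, ← ENNReal.tsum_mul_right]
    rw [ENNReal.tsum_comm]
    refine tsum_congr fun k => tsum_congr fun n => ?_
    rw [connector_comm]
    ring
  rw [h, ← starPairing_add, connectedSum_add_partialSum, starPairing_smul,
    ← starTail_zero_eq_starPairing, mul_comm]

/-! ### Comparison with `mzvStar` -/

lemma monotone_cons_and_le_iff {n m : ℕ} (k : ℕ+) (g : Fin n → ℕ+) :
    (Monotone (Fin.cons k g : Fin (n + 1) → ℕ+) ∧
        ∀ i, m ≤ ((Fin.cons k g : Fin (n + 1) → ℕ+) i : ℕ)) ↔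
      m ≤ (k : ℕ) ∧ Monotone g ∧ ∀ i, (k : ℕ) ≤ g i := by
  constructor
  · rintro ⟨hm, hle⟩
    refine ⟨by simpa using hle 0, fun i j hij => ?_, fun i => ?_⟩
    · simpa using hm (Fin.succ_le_succ_iff.mpr hij)
    · simpa using hm (Fin.zero_le i.succ)
  · rintro ⟨hk, hg, hle⟩
    refine ⟨fun i j hij => ?_, fun i => ?_⟩
    · induction j using Fin.cases with
      | zero => simp [Fin.le_zero_iff.mp hij]
      | succ j =>
        induction i using Fin.cases with
        | zero => simpa using hle j
        | succ i => simpa using hg (Fin.succ_le_succ_iff.mp hij)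
    · induction i using Fin.cases with
      | zero => simpa using hk
      | succ i => simpa using hk.trans (hle i)

open Classical in
lemma tsum_monotone_eq_starTail (α : List ℕ) (m : ℕ) :
    ∑' f : Fin α.length → ℕ+, (if Monotone f ∧ ∀ i, m ≤ (f i : ℕ) then
      ∏ i, (zetaWeight (α.get i) (f i) : ℝ≥0∞) else 0) = starTail α m := by
  induction α generalizing m with
  | nil =>
    change ∑' f : Fin 0 → ℕ+, _ = _
    rw [tsum_eq_single default (fun f hf => absurd (Subsingleton.elim f default) hf)]
    simp [starTail, Subsingleton.monotone]
  | cons a l ih =>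
    change ∑' f : Fin (l.length + 1) → ℕ+, _ = _
    rw [← (Fin.consEquiv fun _ : Fin (l.length + 1) => ℕ+).tsum_eq, ENNReal.tsum_prod', starTail]
    have hpnat : ∀ F : ℕ → ℝ≥0∞, F 0 = 0 → ∑' k : ℕ+, F k = ∑' k : ℕ, F k := fun F h0 =>
      PNat.coe_injective.tsum_eq fun n hn => ⟨⟨n, Nat.pos_of_ne_zero (by
        rintro rfl
        exact hn h0)⟩, rfl⟩
    rw [← hpnat _ (by simp [zetaWeight_zero])]
    refine tsum_congr fun k => ?_
    have hterm : ∀ g : Fin l.length → ℕ+,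
        (if Monotone (Fin.cons k g : Fin (l.length + 1) → ℕ+) ∧
            ∀ i, m ≤ ((Fin.cons k g : Fin (l.length + 1) → ℕ+) i : ℕ) then
          ∏ i : Fin (l.length + 1), (zetaWeight ((a :: l).get i)
            ((Fin.cons k g : Fin (l.length + 1) → ℕ+) i) : ℝ≥0∞) else 0) =
        if m ≤ (k : ℕ) then zetaWeight a k * (if Monotone g ∧ ∀ i, (k : ℕ) ≤ g i then
          ∏ i, (zetaWeight (l.get i) (g i) : ℝ≥0∞) else 0) else 0 := fun g => by
      simp only [monotone_cons_and_le_iff, Fin.prod_univ_succ, mul_ite, mul_zero, ite_and]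
      rfl
    refine (tsum_congr hterm).trans ?_
    by_cases hk : m ≤ (k : ℕ)
    · simp only [hk, if_true, ENNReal.tsum_mul_left, ih]
    · simp [hk]

lemma mzvStar_eq_toReal (α : List ℕ) : mzvStar α = (starTail α 0).toReal := by
  classical
  rw [← tsum_monotone_eq_starTail]
  simp only [zero_le, implies_true, and_true]
  have h : ∀ f : Fin α.length → ℕ+, (if Monotone f then
      ∏ i, (zetaWeight (α.get i) (f i) : ℝ≥0∞) else 0) =
      Set.indicator {f | Monotone f}
        (fun f : Fin α.length → ℕ+ => ∏ i, (zetaWeight (α.get i) (f i) : ℝ≥0∞)) f :=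
    fun f => by simp [Set.indicator_apply]
  simp_rw [h]
  rw [← tsum_subtype, ENNReal.tsum_toReal_eq]
  · refine tsum_congr fun f => ?_
    rw [ENNReal.toReal_prod]
    refine Finset.prod_congr rfl fun i _ => ?_
    simp [zetaWeight]
  · intro f
    exact ENNReal.prod_ne_top fun i _ => ENNReal.coe_ne_top

lemma starTail_eq_starPairing {l : List ℕ} (hl : l ≠ []) : starTail l 0 = starPairing 1 l := by
  cases l with
  | nil => exact absurd rfl hl
  | cons a l => exact starTail_zero_eq_starPairing a l

lemma starTail_add_two_ne_top (a s : ℕ) : starTail ((a + 2) :: List.replicate s 2) 0 ≠ ⊤ := by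
  refine ne_top_of_le_ne_top (starTail_replicate_two_ne_top (s + 1)) ?_
  rw [List.replicate_succ, starTail, starTail]
  refine ENNReal.tsum_le_tsum fun n => ?_
  simp only [zero_le, if_true]
  gcongr
  rcases eq_or_ne n 0 with rfl | hn
  · simp [zetaWeight]
  · simp only [zetaWeight, hn, if_false]
    have h1 : (1 : ℝ≥0) ≤ n := by exact_mod_cast Nat.one_le_iff_ne_zero.mpr hn
    gcongr
    omega

/-- Telescoping of an alternating sum of consecutive sums. -/
lemma sum_range_neg_one_pow_mul_add (U : ℕ → ℝ) (m : ℕ) :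
    ∑ a ∈ Finset.range m, (-1) ^ a * (U a + U (a + 1)) = U 0 - (-1) ^ m * U m := by
  induction m with
  | zero => simp
  | succ m ih =>
    rw [Finset.sum_range_succ, ih]
    ring

end

/-- Theorem 1.4 / 5.1, Eq. (5.1). -/
theorem stmt_6 (p q r : ℕ) (hp : 0 < p) (hq : 0 < q) :
    mzvStar (List.replicate p 2 ++ List.replicate r 1 ++ List.replicate q 2) +
      (-1 : ℝ) ^ (r + 1) *
        mzvStar (List.replicate q 2 ++ (r + 2) :: List.replicate (p - 1) 2)
    = ∑ a ∈ Finset.range r,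
        (-1 : ℝ) ^ a * mzvStar ((a + 2) :: List.replicate (p - 1) 2) *
          mzvStar (List.replicate (r - a) 1 ++ List.replicate q 2) := by
  obtain ⟨p, rfl⟩ := Nat.exists_eq_succ_of_ne_zero hp.ne'
  obtain ⟨q, rfl⟩ := Nat.exists_eq_succ_of_ne_zero hq.ne'
  simp only [Nat.succ_eq_add_one, Nat.add_sub_cancel]
  set Φ : (ℕ → ℝ≥0∞) → ℝ≥0∞ := fun f => starPairing f (2 :: List.replicate q 2) with hΦ
  -- `U 0` is the first star value, `U (a + 1)` a connected sum of weight shift `a`.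
  let U : ℕ → ℝ≥0∞
    | 0 => Φ ((partialSum 1 ^ r) ((partialSum 2 ^ (p + 1)) 1))
    | a + 1 => Φ ((partialSum 1 ^ (r - a)) (connectedSum p a))
  have hZ : ∀ j, starTail (List.replicate j 1 ++ List.replicate (q + 1) 2) 0 =
      Φ ((partialSum 1 ^ j) 1) := fun j => by
    rw [starTail_eq_starPairing (by simp), starPairing_replicate_append _ _ (by simp),
      List.replicate_succ]
  have hF : starTail (List.replicate (p + 1) 2 ++ List.replicate r 1 ++
      List.replicate (q + 1) 2) 0 = U 0 := by
    rw [starTail_eq_starPairing (by simp), List.append_assoc,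
      starPairing_replicate_append _ _ (by simp), starPairing_replicate_append _ _ (by simp),
      List.replicate_succ (n := q)]
  have hstep : ∀ a ≤ r, U a + U (a + 1) =
      starTail ((a + 2) :: List.replicate p 2) 0 * Φ ((partialSum 1 ^ (r - a)) 1) := by
    intro a ha
    cases a with
    | zero =>
      simp only [U, hΦ, Nat.sub_zero]
      rw [← starPairing_add, ← map_add, add_comm, connectedSum_add_partialSum, map_smul,
        starPairing_smul, List.replicate_succ]
    | succ a =>
      simp only [U, hΦ]
      rw [show r - a = (r - (a + 1)) + 1 by omega, pow_succ, Module.End.mul_apply,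
        ← starPairing_add, ← map_add, add_comm (partialSum 1 _), connectedSum_succ_add_partialSum, map_smul,
        starPairing_smul]
  have hfin : ∀ a ≤ r, U a ≠ ⊤ ∧ U (a + 1) ≠ ⊤ := by
    intro a ha
    rw [← ENNReal.add_ne_top, hstep a ha]
    exact ENNReal.mul_ne_top (starTail_add_two_ne_top a p)
      (starPairing_partialSum_one_pow_ne_top _ _)
  have hB : starTail (List.replicate (q + 1) 2 ++ (r + 2) :: List.replicate p 2) 0 = U r := by
    have h := starPairing_connectedSum_add p q r
    have h' := hstep r le_rfl
    have hΦ1 : Φ ((partialSum 1 ^ (r - r)) 1) = starTail (List.replicate (q + 1) 2) 0 := by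
      rw [← hZ, Nat.sub_self, List.replicate_zero, List.nil_append]
    have hU : U (r + 1) = starPairing (connectedSum p r) (2 :: List.replicate q 2) := by
      simp [U, hΦ]
    rw [hΦ1, ← h, add_comm, ← hU, ENNReal.add_right_inj (hfin r le_rfl).2] at h'
    rw [h', starTail_eq_starPairing (by simp), starPairing_replicate_append _ _ (by simp)]
  simp only [mzvStar_eq_toReal, hF, hB, hZ]
  have hsum := sum_range_neg_one_pow_mul_add (fun a => (U a).toReal) r
  rw [pow_succ, show (U 0).toReal + (-1) ^ r * -1 * (U r).toReal =
    (U 0).toReal - (-1) ^ r * (U r).toReal by ring, ← hsum]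
  refine Finset.sum_congr rfl fun a ha => ?_
  have ha' : a ≤ r := (Finset.mem_range.mp ha).le
  rw [← ENNReal.toReal_add (hfin a ha').1 (hfin a ha').2, hstep a ha', ENNReal.toReal_mul,
    mul_assoc]
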